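/- Let 𝒜 be a complex unital Banach algebra, let n ≥ 1 be an integer, and let a ∈ 𝒜. Then a is pns-Drazin invertible if and only if a^n − a^{2n} ∈ √J(𝒜). -/

import Mathlib

variable {A : Type*} [NormedRing A] [NormedAlgebra ℂ A] [CompleteSpace A]

/-- Membership in the Jacobson radical `J(𝒜) = {a : 1 + a y is invertible for all y}`. -/
def InJacobsonRadical (a : A) : Prop := ∀ y : A, IsUnit (1 + a * y)

/-- Membership in `√J(𝒜) = {a : a ^ k ∈ J(𝒜) for some k ≥ 1}`. -/
def InSqrtJacobsonRadical (a : A) : Prop := ∃ k : ℕ, 1 ≤ k ∧ InJacobsonRadical (a ^ k)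

/-- `a` is pseudo `n`-strong Drazin invertible (pns-Drazin invertible): there is `x`
commuting with every element commuting with `a`, with `x * a * x = x` and
`(a ^ n - a * x) ^ k ∈ J(𝒜)` for some `k ≥ 1`. -/
def IsPnsDrazinInvertible (n : ℕ) (a : A) : Prop :=
  ∃ x : A, (∀ y : A, y * a = a * y → x * y = y * x) ∧ x * a * x = x ∧
    ∃ k : ℕ, 1 ≤ k ∧ InJacobsonRadical ((a ^ n - a * x) ^ k)


lemma InJacobsonRadical.mul_right' {b : A} (h : InJacobsonRadical b) (c : A) :
    InJacobsonRadical (b * c) := fun y => by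
  have := h (c * y)
  rwa [← mul_assoc] at this

/-- if `w = c * s`, commuting, `c ^ k ∈ J` then `1 + w` is a unit -/
lemma isUnit_one_add_of_pow {c s : A} (hcs : Commute c s) {k : ℕ}
    (h : InJacobsonRadical (c ^ k)) : IsUnit (1 + c * s) := by
  have h1 : IsUnit (1 - (-(c * s)) ^ k) := by
    have := h (-((-s) ^ k))
    rw [← mul_neg, (hcs.neg_right).mul_pow, sub_eq_add_neg, ← mul_neg]
    exact this
  rw [← mul_neg_geom_sum (-(c*s)) k] at h1
  have h2 : Commute (1 - -(c*s)) (∑ i ∈ Finset.range k, (-(c*s)) ^ i) := by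
    apply Commute.sum_right
    intro i _
    exact ((Commute.one_left _).sub_left (Commute.refl _)).pow_right i
  have := (h2.isUnit_mul_iff.1 h1).1
  simpa using this

lemma norm_pow_bound {c : A} {k : ℕ} (h : InJacobsonRadical (c ^ k)) :
    ∀ᶠ m : ℕ in Filter.atTop, ‖c ^ m‖ ≤ (1/8 : ℝ) ^ m := by
  have hr : spectralRadius ℂ c = 0 := by
    rw [spectralRadius]
    simp only [ENNReal.iSup_eq_zero]
    intro l hl
    by_contra hne
    have hl0 : l ≠ 0 := by rintro rfl; simp at hne
    apply hl
    have hu : IsUnit (1 + c * algebraMap ℂ A (-l⁻¹)) :=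
      isUnit_one_add_of_pow (Algebra.commutes _ _).symm h
    have e : algebraMap ℂ A l - c = algebraMap ℂ A l * (1 + c * algebraMap ℂ A (-l⁻¹)) := by
      rw [mul_add, mul_one, ← Algebra.commutes (-l⁻¹) c, ← mul_assoc, ← map_mul]
      simp [hl0, sub_eq_add_neg]
    show IsUnit (algebraMap ℂ A l - c)
    rw [e]
    exact ((IsUnit.mk0 l hl0).map (algebraMap ℂ A)).mul hu
  have ht := spectrum.pow_nnnorm_pow_one_div_tendsto_nhds_spectralRadius c
  rw [hr] at ht
  have h8 : (0 : ENNReal) < ((1/8 : NNReal) : ENNReal) := by simp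
  filter_upwards [ht.eventually (gt_mem_nhds h8), Filter.eventually_gt_atTop 0] with m hm hm0
  have h2 := ENNReal.rpow_le_rpow hm.le (z := (m : ℝ)) (by positivity)
  rw [← ENNReal.rpow_mul, one_div, inv_mul_cancel₀ (by positivity), ENNReal.rpow_one,
    ENNReal.rpow_natCast] at h2
  have h3 : ‖c ^ m‖₊ ≤ (1/8 : NNReal) ^ m := by exact_mod_cast h2
  have h4 : ((‖c ^ m‖₊ : NNReal) : ℝ) ≤ (((1/8 : NNReal) ^ m : NNReal) : ℝ) := by exact_mod_cast h3
  simpa using h4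

lemma catalan_le_four_pow (m : ℕ) : catalan m ≤ 4 ^ m := by
  rw [catalan_eq_centralBinom_div]
  refine (Nat.div_le_self _ _).trans ?_
  rw [Nat.centralBinom_eq_two_mul_choose]
  refine (Nat.choose_le_two_pow _ _).trans ?_
  rw [pow_mul]; norm_num

lemma summable_catalan {c : A} {k : ℕ} (h : InJacobsonRadical (c ^ k)) :
    Summable (fun m : ℕ => ‖catalan m • c ^ m‖) := by
  have hg : Summable (fun m : ℕ => (1/2 : ℝ) ^ m) := summable_geometric_two
  refine summable_of_isBigO_nat hg (Asymptotics.IsBigO.of_bound 1 ?_)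
  filter_upwards [norm_pow_bound h] with m hm
  rw [norm_norm, one_mul, Real.norm_of_nonneg (by positivity)]
  refine (norm_nsmul_le).trans ?_
  have h1 : (catalan m : ℝ) ≤ 4 ^ m := by exact_mod_cast catalan_le_four_pow m
  calc (catalan m : ℝ) * ‖c ^ m‖ ≤ 4 ^ m * (1/8) ^ m := by gcongr
    _ = (1/2) ^ m := by rw [← mul_pow]; norm_num

lemma exists_catalan_series {c : A} {k : ℕ} (h : InJacobsonRadical (c ^ k)) :
    ∃ s : A, (∀ y, Commute y c → Commute y s) ∧ s = 1 + c * (s * s) := by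
  have hs := summable_catalan h
  refine ⟨∑' m : ℕ, catalan m • c ^ m, ?_, ?_⟩
  · intro y hy
    show y * _ = _ * y
    rw [← hs.of_norm.tsum_mul_left, ← hs.of_norm.tsum_mul_right]
    congr 1; ext m
    exact (hy.pow_right m).smul_right (catalan m)
  · rw [tsum_mul_tsum_eq_tsum_sum_antidiagonal_of_summable_norm hs hs]
    have e : ∀ m : ℕ, (∑ kl ∈ Finset.HasAntidiagonal.antidiagonal m,
        (catalan kl.1 • c ^ kl.1) * (catalan kl.2 • c ^ kl.2)) = catalan (m + 1) • c ^ m := by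
      intro m
      rw [catalan_succ', Finset.sum_smul]
      refine Finset.sum_congr rfl fun x hx => ?_
      rw [Finset.HasAntidiagonal.mem_antidiagonal] at hx
      rw [smul_mul_smul_comm, ← pow_add, hx]
    have hS := (summable_norm_sum_mul_antidiagonal_of_summable_norm hs hs).of_norm
    rw [← hS.tsum_mul_left, hs.of_norm.tsum_eq_zero_add]
    simp only [e, catalan_zero, pow_zero, one_smul]
    congr 2; ext m
    rw [mul_smul_comm, ← pow_succ']

/-- The commutative-algebra core. -/
lemma backward (n : ℕ) (hn : 1 ≤ n) (a : A) (h : InSqrtJacobsonRadical (a ^ n - a ^ (2 * n))) :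
    IsPnsDrazinInvertible n a := by
  obtain ⟨k, hk, hJ⟩ := h
  obtain ⟨b, hb⟩ : ∃ b, b = a ^ n := ⟨_, rfl⟩
  obtain ⟨c, hc⟩ : ∃ c, c = b - b * b := ⟨_, rfl⟩
  have hcc : a ^ n - a ^ (2 * n) = c := by rw [hc, hb, two_mul, pow_add]
  rw [hcc] at hJ
  obtain ⟨s, hsc, hs⟩ := exists_catalan_series hJ
  have Yb : ∀ y, Commute y a → Commute y b := fun y hy => hb ▸ hy.pow_right n
  have Yc : ∀ y, Commute y a → Commute y c := fun y hy =>
    hc ▸ (Yb y hy).sub_right ((Yb y hy).mul_right (Yb y hy))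
  have Ys : ∀ y, Commute y a → Commute y s := fun y hy => hsc y (Yc y hy)
  have ba : Commute b a := (Yb a rfl).symm
  have ca : Commute c a := (Yc a rfl).symm
  have sa : Commute s a := (Ys a rfl).symm
  have cs := Ys c ca
  obtain ⟨U, hU⟩ : IsUnit (1 + c * (-2 * s)) :=
    isUnit_one_add_of_pow (((Commute.ofNat_right c 2).neg_right).mul_right cs) hJ
  have Two : ∀ y : A, Commute y (-2 : A) := fun y => (Commute.ofNat_right y 2).neg_right
  have YU : ∀ y, Commute y a → Commute y (U : A) := fun y hy => hU ▸
    (Commute.one_right y).add_right ((Yc y hy).mul_right ((Two y).mul_right (Ys y hy)))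
  obtain ⟨u, hu⟩ : ∃ u : A, u = ↑U⁻¹ := ⟨_, rfl⟩
  have Yu : ∀ y, Commute y a → Commute y u := fun y hy => hu ▸ (YU y hy).units_inv_right
  have ua : Commute u a := (Yu a rfl).symm
  have hUu : (1 + c * (-2 * s)) * u = 1 := by rw [← hU, hu]; simp
  obtain ⟨p, hp⟩ : ∃ p, p = (b - c * s) * u := ⟨_, rfl⟩
  have Yp : ∀ y, Commute y a → Commute y p := fun y hy => hp ▸
    ((Yb y hy).sub_right ((Yc y hy).mul_right (Ys y hy))).mul_right (Yu y hy)
  have pa : Commute p a := (Yp a rfl).symm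
  have e1 := (Yb c ca).eq
  have e2 := (Yb s sa).eq
  have e3 := (Yb u ua).eq
  have e4 := (Ys c ca).eq
  have e5 := (Yu c ca).eq
  have e6 := (Yu s sa).eq
  obtain ⟨d, hd⟩ : ∃ d, d = s * (1 - 2 * b) * u := ⟨_, rfl⟩
  have Yd : ∀ y, Commute y a → Commute y d := fun y hy => hd ▸
    ((Ys y hy).mul_right ((Commute.one_right y).sub_right
      ((Commute.ofNat_right y 2).mul_right (Yb y hy)))).mul_right (Yu y hy)
  have hbp : b - p = c * d := by
    have : b - p = b * ((1 + c * (-2 * s)) * u) - p := by rw [hUu, mul_one]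
    have k1 : b * (1 + c * (-2 * s)) - (b - c * s) = c * (s * (1 - 2 * b)) := by
      have t : c * (s * (2 * b)) = 2 * (b * (c * s)) := by
        rw [two_mul, mul_add, e2, mul_add, ← mul_assoc, e1, mul_assoc, two_mul]
      rw [mul_sub, mul_sub, t]
      noncomm_ring
    rw [this, hp, hd, ← mul_assoc b, ← sub_mul, k1, mul_assoc]
  have hpp : p * p = p := by
    obtain ⟨q, hq⟩ : ∃ q, q = c * s := ⟨_, rfl⟩
    have hqq : q = c + q * q := by
      have : q * q = c * (c * (s * s)) := by
        rw [hq, mul_assoc, ← mul_assoc s, ← e4, mul_assoc]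
      rw [this, hq]
      conv_lhs => rw [hs]
      rw [mul_add, mul_one]
    have qb : q * b = b * q := by rw [hq, mul_assoc, e2, ← mul_assoc, e1, mul_assoc]
    have qu : q * u = u * q := by rw [hq, mul_assoc, e6, ← mul_assoc, e5, mul_assoc]
    have ub : u * (b - q) = (b - q) * u := by rw [mul_sub, sub_mul, e3, qu]
    have hU2 : (1 - 2 * q) * u = 1 := by
      have t : (1 - 2 * q) = 1 + c * (-2 * s) := by rw [hq]; noncomm_ring
      rw [t, hUu]
    have key : (b - q) * (b - q) = (b - q) * (1 - 2 * q) := by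
      have h1 : b - b * b = q - q * q := by
        rw [← hc]; exact eq_sub_of_add_eq hqq.symm
      have h2 : (b - q) * (b - q) - (b - q) * (1 - 2 * q)
          = (q - q * q) - (b - b * b) + (b * q - q * b) := by noncomm_ring
      rw [← sub_eq_zero, h2, h1, qb]; simp
    have h3 : p = (b - q) * u := by rw [hp, hq]
    calc p * p = (b - q) * (u * (b - q)) * u := by rw [h3]; simp only [mul_assoc]
      _ = (b - q) * (b - q) * u * u := by rw [ub]; simp only [mul_assoc]
      _ = (b - q) * ((1 - 2 * q) * u) * u := by rw [key]; simp only [mul_assoc]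
      _ = p := by rw [hU2, mul_one, h3]
  obtain ⟨V, hV⟩ : IsUnit (1 + c * d) := isUnit_one_add_of_pow (Yd c ca) hJ
  have YV : ∀ y, Commute y a → Commute y (V : A) := fun y hy => hV ▸
    (Commute.one_right y).add_right ((Yc y hy).mul_right (Yd y hy))
  obtain ⟨v, hv⟩ : ∃ v : A, v = ↑V⁻¹ := ⟨_, rfl⟩
  have Yv : ∀ y, Commute y a → Commute y v := fun y hy => hv ▸ (YV y hy).units_inv_right
  have hVv : (1 + c * d) * v = 1 := by rw [← hV, hv]; simp
  have hax : a * (a ^ (n - 1) * p * v) = p := by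
    have h1 : a * (a ^ (n - 1) * p * v) = b * p * v := by
      rw [← mul_assoc, ← mul_assoc, ← pow_succ', Nat.sub_add_cancel hn, hb]
    have h2 : b * p = p * (1 + c * d) := by
      rw [← hbp, mul_add, mul_sub, hpp, (Yb p pa).eq]; simp
    rw [h1, h2, mul_assoc, hVv, mul_one]
  refine ⟨a ^ (n - 1) * p * v, ?_, ?_, k, hk, ?_⟩
  · intro y hy
    have hy' : Commute y a := hy
    exact (((hy'.pow_right _).mul_right (Yp y hy')).mul_right (Yv y hy')).eq.symm
  · rw [mul_assoc _ a, hax, mul_assoc _ v p, ← (Yv p pa).eq, mul_assoc (a ^ _) p, ← mul_assoc p p,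
      hpp, ← mul_assoc]
  · rw [hax, ← hb, hbp, (Yd c ca).mul_pow]
    exact hJ.mul_right' _

lemma forward (n : ℕ) (a : A) (h : IsPnsDrazinInvertible n a) :
    InSqrtJacobsonRadical (a ^ n - a ^ (2 * n)) := by
  obtain ⟨x, hx, hxx, k, hk, hJ⟩ := h
  refine ⟨k, hk, ?_⟩
  have xa : Commute x a := hx a rfl
  have hp : (a * x) * (a * x) = a * x := by rw [mul_assoc, ← mul_assoc x, hxx]
  have pa : Commute (a * x) (a ^ n) := ((Commute.refl a).mul_left xa).pow_right n
  have hw : Commute (a ^ n - a * x) (1 - a ^ n - a * x) := by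
    have r1 := (Commute.refl (a ^ n))
    have r2 := (Commute.refl (a * x))
    exact (((Commute.one_right _).sub_right r1).sub_right pa.symm).sub_left
      (((Commute.one_right _).sub_right pa).sub_right r2)
  have e : a ^ n - a ^ (2 * n) = (a ^ n - a * x) * (1 - a ^ n - a * x) := by
    rw [two_mul, pow_add]
    have := pa.eq
    generalize a ^ n = b at *
    generalize a * x = p at *
    simp only [mul_sub, sub_mul, mul_one, hp, this]
    abel
  rw [e, hw.mul_pow]
  exact hJ.mul_right' _

theorem isPnsDrazinInvertible_iff_pow (n : ℕ) (hn : 1 ≤ n) (a : A) :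
    IsPnsDrazinInvertible n a ↔ InSqrtJacobsonRadical (a ^ n - a ^ (2 * n)) := by
  exact ⟨forward n a, backward n hn a⟩
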